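/- arXiv:2201.12949 — 3 statements merged into one kernel-verified Lean document; each statement's English description precedes it below -/
import Mathlib

section
/- For every permutation w of {1,…,n}, the sum of the length and the reflection length of w is at most the total displacement of w: ℓ(w) + ℓ_T(w) ≤ td(w). -/
/-- The (Coxeter) length of a permutation: its number of inversions,
i.e. pairs `(a,b)` with `a < b` and `w a > w b`. -/
def invLen {n : ℕ} (w : Equiv.Perm (Fin n)) : ℕ :=
  (Finset.univ.filter (fun p : Fin n × Fin n => p.1 < p.2 ∧ w p.2 < w p.1)).card

/-- The number of cycles in the cycle decomposition of `w`,
where fixed points count as cycles. -/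
def numCycles {n : ℕ} (w : Equiv.Perm (Fin n)) : ℕ :=
  w.cycleType.card + (Finset.univ.filter (fun i : Fin n => w i = i)).card

/-- The reflection length of a permutation of `{1,…,n}`: `n` minus the number of
cycles in its cycle decomposition (fixed points counting as cycles). -/
def reflLen {n : ℕ} (w : Equiv.Perm (Fin n)) : ℕ :=
  n - numCycles w

/-- The total displacement `td(w) = Σ_i |w(i) - i|`. -/
def totalDisp {n : ℕ} (w : Equiv.Perm (Fin n)) : ℕ :=
  ∑ i : Fin n, ((w i : ℤ) - (i : ℤ)).natAbs

/-- A permutation is shallow if `ℓ(w) + ℓ_T(w) = td(w)`. -/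
def IsShallow {n : ℕ} (w : Equiv.Perm (Fin n)) : Prop :=
  invLen w + reflLen w = totalDisp w

/-- The `i`-th flattening of `w`: remove the `i`-th entry of the one-line notation
and renumber down by one every entry greater than `w i`.  Position `k` of `Fin n`
corresponds to position `i.succAbove k` of `Fin (n+1)`, and value `m` corresponds
to value `(w i).succAbove m`; this is implemented by deleting the point `i` from the
source and `w i` from the target via `finSuccEquiv'`. -/
def flatten {n : ℕ} (w : Equiv.Perm (Fin (n + 1))) (i : Fin (n + 1)) : Equiv.Perm (Fin n) :=
  Equiv.removeNone ((finSuccEquiv' i).symm.trans (w.trans (finSuccEquiv' (w i))))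

/-- `v` has a left-to-right maximum at position `j` if `v j > v i` for all `i < j`. -/
def LeftToRightMaxAt {m : ℕ} (v : Equiv.Perm (Fin m)) (j : Fin m) : Prop :=
  ∀ i : Fin m, i < j → v i < v j

/-- `v` has a right-to-left minimum at position `j` if `v j < v i` for all `i > j`. -/
def RightToLeftMinAt {m : ℕ} (v : Equiv.Perm (Fin m)) (j : Fin m) : Prop :=
  ∀ i : Fin m, j < i → v j < v i

namespace Equiv.Perm

/-- Sends a fixed point of `w` to itself and any other point to its cycle. -/
def cycleLabel {n : ℕ} (w : Equiv.Perm (Fin n)) (x : Fin n) : Equiv.Perm (Fin n) ⊕ Fin n :=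
  if w x = x then Sum.inr x else Sum.inl (w.cycleOf x)

theorem cycleLabel_eq_iff {n : ℕ} (w : Equiv.Perm (Fin n)) (x y : Fin n) :
    cycleLabel w x = cycleLabel w y ↔ w.SameCycle x y := by
  unfold cycleLabel
  by_cases hx : w x = x
  · by_cases hy : w y = y
    · simp only [hx, hy, if_true, Sum.inr.injEq]
      exact ⟨fun h => h ▸ SameCycle.refl _ _, fun h => h.eq_of_left hx⟩
    · simp only [hx, hy, if_true, if_false, reduceCtorEq, false_iff]
      exact fun h => hy (h.apply_eq_self_iff.1 hx)
  · by_cases hy : w y = y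
    · simp only [hx, hy, if_true, if_false, reduceCtorEq, false_iff]
      exact fun h => hx (h.apply_eq_self_iff.2 hy)
    · simp only [hx, hy, if_false, Sum.inl.injEq]
      exact (sameCycle_iff_cycleOf_eq_of_mem_support (mem_support.2 hx) (mem_support.2 hy)).symm

theorem image_cycleLabel {n : ℕ} (w : Equiv.Perm (Fin n)) :
    Finset.univ.image (cycleLabel w) =
      w.cycleFactorsFinset.disjSum (Finset.univ.filter fun i => w i = i) := by
  ext (c | i)
  · simp only [Finset.mem_image, Finset.mem_univ, true_and, Finset.inl_mem_disjSum, cycleLabel]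
    constructor
    · rintro ⟨x, hx⟩
      split_ifs at hx with h
      cases hx
      exact cycleOf_mem_cycleFactorsFinset_iff.2 (mem_support.2 h)
    · intro hc
      obtain ⟨x, hx⟩ := (mem_cycleFactorsFinset_iff.1 hc).1.nonempty_support
      refine ⟨x, ?_⟩
      rw [if_neg (mem_support.1 (mem_cycleFactorsFinset_support_le hc hx)),
        ← cycle_is_cycleOf hx hc]
  · simp only [Finset.mem_image, Finset.mem_univ, true_and, Finset.inr_mem_disjSum, cycleLabel,
      Finset.mem_filter]
    constructor
    · rintro ⟨x, hx⟩
      split_ifs at hx with h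
      cases hx
      exact h
    · exact fun h => ⟨i, if_pos h⟩

end Equiv.Perm

open Equiv.Perm in
theorem numCycles_eq_card_quotient {n : ℕ} (w : Equiv.Perm (Fin n)) :
    numCycles w = Nat.card (Quotient (SameCycle.setoid w)) := by
  have hrange : numCycles w = Nat.card (Set.range (cycleLabel w)) := by
    have : Set.range (cycleLabel w) = ↑(Finset.univ.image (cycleLabel w)) := by simp
    rw [this, Nat.card_coe_set_eq, Set.ncard_coe_finset, image_cycleLabel, Finset.card_disjSum,
      numCycles, cycleType_def, Multiset.card_map, Finset.card_val]
  rw [hrange]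
  have : SameCycle.setoid w = Setoid.ker (cycleLabel w) :=
    Setoid.ext fun x y => (cycleLabel_eq_iff w x y).symm
  rw [this]
  exact (Nat.card_congr (Setoid.quotientKerEquivRange _)).symm

theorem numCycles_le {n : ℕ} (w : Equiv.Perm (Fin n)) : numCycles w ≤ n := by
  rw [numCycles_eq_card_quotient]
  simpa using Nat.card_le_card_of_surjective _
    (Quotient.mk_surjective (s := Equiv.Perm.SameCycle.setoid w))

/-- Splitting the cycle of `m` by making `m` a fixed point adds at most one cycle. -/
theorem numCycles_mul_swap_le {n : ℕ} (w : Equiv.Perm (Fin n)) {j m : Fin n}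
    (hj : w j = m) (hjm : j ≠ m) :
    numCycles (w * Equiv.swap j m) ≤ numCycles w + 1 := by
  set v := w * Equiv.swap j m with hv
  have hvj : v j = w m := by simp [hv]
  have hvne : ∀ x, x ≠ j → x ≠ m → v x = w x := fun x h1 h2 => by
    simp [hv, Equiv.swap_apply_of_ne_of_ne h1 h2]
  let r : Fin n → Fin n := fun x => if x = m then j else x
  have step : ∀ x, v.SameCycle (r x) (r (w x)) := by
    intro x
    by_cases hxm : x = m
    · subst hxm
      have : w x ≠ x := fun h => hjm (w.injective (hj.trans h.symm))
      simp only [r, if_true, this, if_false]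
      rw [← hvj]
      exact Equiv.Perm.sameCycle_apply_right.2 (.refl _ _)
    · by_cases hxj : x = j
      · subst hxj
        simp only [r, hj, hxm, if_true, if_false]
        exact .refl _ _
      · have : w x ≠ m := fun h => hxj (w.injective (h.trans hj.symm))
        simp only [r, hxm, this, if_false]
        rw [← hvne x hxj hxm]
        exact Equiv.Perm.sameCycle_apply_right.2 (.refl _ _)
  have lift : ∀ x y, w.SameCycle x y → v.SameCycle (r x) (r y) := by
    intro x y h
    obtain ⟨k, -, -, rfl⟩ := h.exists_pow_eq w
    induction k with
    | zero => exact .refl _ _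
    | succ k ih =>
      rw [pow_succ', Equiv.Perm.mul_apply]
      exact (ih ⟨k, by simp⟩).trans (step _)
  rw [numCycles_eq_card_quotient, numCycles_eq_card_quotient, ← Finite.card_option]
  let F : Option (Quotient (Equiv.Perm.SameCycle.setoid w)) →
      Quotient (Equiv.Perm.SameCycle.setoid v) := fun o => o.elim (Quotient.mk _ m)
        (Quotient.map r lift)
  refine Nat.card_le_card_of_surjective F fun q => ?_
  induction q using Quotient.inductionOn with
  | h x =>
    by_cases hx : x = m
    · exact ⟨none, by rw [hx]; rfl⟩
    · refine ⟨some (Quotient.mk _ x), ?_⟩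
      change Quotient.mk _ (r x) = _
      simp [r, hx]

theorem reflLen_le_mul_swap {n : ℕ} (w : Equiv.Perm (Fin n)) {j m : Fin n}
    (hj : w j = m) (hjm : j ≠ m) :
    reflLen w ≤ reflLen (w * Equiv.swap j m) + 1 := by
  have := numCycles_mul_swap_le w hj hjm
  have := numCycles_le (w * Equiv.swap j m)
  unfold reflLen
  omega

/-- If `m` is the largest point moved by `w` and `w j = m`, then making `m` a fixed point removes
at most `2 (m - max j (w m)) - 1` inversions. -/
theorem invLen_le_mul_swap {n : ℕ} (w : Equiv.Perm (Fin n)) {j m : Fin n}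
    (hj : w j = m) (hjm : j < m) (hkm : w m < m) (hfix : ∀ i, m < i → w i = i) :
    invLen w + 2 * max j.val (w m).val + 1 ≤ invLen (w * Equiv.swap j m) + 2 * m := by
  set v := w * Equiv.swap j m with hv
  have hvj : v j = w m := by simp [hv]
  have hvm : v m = m := by simp [hv, hj]
  have hvne : ∀ x, x ≠ j → x ≠ m → v x = w x := fun x h1 h2 => by
    simp [hv, Equiv.swap_apply_of_ne_of_ne h1 h2]
  have hlt : ∀ i, i < m → i ≠ j → w i < m := fun i hi hij => by
    by_contra! h
    rcases h.eq_or_lt with h | h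
    · exact hij (w.injective (h.symm.trans hj.symm))
    · exact absurd (w.injective (hfix _ h)) (hi.trans h).ne'
  let S : Finset (Fin n) := Finset.univ.filter fun i => j < i ∧ i < m ∧ w m < w i
  have hSj : S.card + j + 1 ≤ m := by
    have : S ⊆ Finset.Ioo j m := fun i hi => by
      simp only [S, Finset.mem_filter] at hi
      exact Finset.mem_Ioo.2 ⟨hi.2.1, hi.2.2.1⟩
    have := Finset.card_le_card this
    rw [Fin.card_Ioo] at this
    have : j.val < m.val := hjm
    omega
  have hSk : S.card + w m + 1 ≤ m := by
    have : S.image w ⊆ Finset.Ioo (w m) m := fun i hi => by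
      simp only [S, Finset.mem_image, Finset.mem_filter] at hi
      obtain ⟨a, ⟨-, h1, h2, h3⟩, rfl⟩ := hi
      exact Finset.mem_Ioo.2 ⟨h3, hlt a h2 h1.ne'⟩
    have := Finset.card_le_card this
    rw [Fin.card_Ioo, Finset.card_image_of_injective _ w.injective] at this
    have : (w m).val < m.val := hkm
    omega
  let A : Finset (Fin n × Fin n) := Finset.univ.filter fun p => p.1 < p.2 ∧ w p.2 < w p.1
  let B : Finset (Fin n × Fin n) := Finset.univ.filter fun p => p.1 < p.2 ∧ v p.2 < v p.1
  let f : Fin n × Fin n → Fin n × Fin n := fun p => if p.2 = m then (p.1, j) else p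
  let E : Finset (Fin n × Fin n) :=
    insert (j, m) (S.image (fun i => (j, i)) ∪ S.image (fun i => (i, m)))
  have hE : E.card ≤ 2 * S.card + 1 := by
    refine (Finset.card_insert_le _ _).trans ?_
    have := Finset.card_union_le (S.image (fun i => (j, i))) (S.image (fun i => (i, m)))
    have := Finset.card_image_le (s := S) (f := fun i => (j, i))
    have := Finset.card_image_le (s := S) (f := fun i => (i, m))
    omega
  have hnotj : ∀ p ∈ A, p.2 ≠ j := by
    rintro ⟨a, b⟩ hp rfl
    simp only [A, Finset.mem_filter, hj] at hp
    exact absurd (hlt a (hp.2.1.trans hjm) hp.2.1.ne) hp.2.2.not_gt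
  have hAB : (A \ E).card ≤ B.card := by
    refine Finset.card_le_card_of_injOn f ?_ ?_
    · rintro ⟨a, b⟩ hp
      have hp := Finset.mem_sdiff.1 (Finset.mem_coe.1 hp)
      have hbj := hnotj _ hp.1
      simp only [A, E, S, Finset.mem_filter, Finset.mem_univ, true_and, Finset.mem_insert,
        Finset.mem_union, Finset.mem_image, Prod.mk.injEq, not_or, not_exists, not_and] at hp hbj
      obtain ⟨⟨hab, hw⟩, h1, h2, h3⟩ := hp
      have h2' := h2 b
      have h3' := h3 a
      have hbm : b ≤ m := by
        by_contra! hb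
        rw [hfix b hb] at hw
        have := hfix a (by
          by_contra! ha
          rcases ha.eq_or_lt with rfl | ha
          · exact absurd (hw.trans hkm) hb.not_gt
          · by_cases haj : a = j
            · subst haj; rw [hj] at hw; exact absurd hw hb.not_gt
            · exact absurd (hw.trans (hlt a ha haj)) hb.not_gt)
        rw [this] at hw
        exact absurd hw hab.not_gt
      simp only [f, B, Finset.coe_filter, Finset.mem_univ, true_and, Set.mem_ofPred_eq]
      by_cases hb : b = m
      · subst hb
        have haj : a ≠ j := fun h => h1 h rfl
        have : a < j := by
          rcases lt_or_gt_of_ne haj with h | h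
          · exact h
          · exact absurd rfl (fun e => h3' ⟨h, hab, hw⟩ rfl e)
        simp only [if_true]
        exact ⟨this, by rw [hvj, hvne a haj hab.ne]; exact hw⟩
      · have hbm' := lt_of_le_of_ne hbm hb
        simp only [hb, if_false]
        refine ⟨hab, ?_⟩
        rw [hvne b hbj hb]
        by_cases haj : a = j
        · subst haj
          rw [hvj]
          by_contra! h
          have := lt_of_le_of_ne h (fun e => hb (w.injective e).symm)
          exact h2' ⟨hab, hbm', this⟩ rfl rfl
        · rwa [hvne a haj (hab.trans hbm').ne]
    · rintro ⟨a, b⟩ hp ⟨c, d⟩ hq h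
      have hp := hnotj _ (Finset.mem_sdiff.1 (Finset.mem_coe.1 hp)).1
      have hq := hnotj _ (Finset.mem_sdiff.1 (Finset.mem_coe.1 hq)).1
      simp only [f] at h hp hq
      grind
  have h1 := Finset.card_le_card_sdiff_add_card (s := A) (t := E)
  change A.card + _ + 1 ≤ B.card + _
  omega

theorem totalDisp_mul_swap {n : ℕ} (w : Equiv.Perm (Fin n)) {j m : Fin n}
    (hj : w j = m) (hjm : j < m) (hkm : w m < m) :
    totalDisp w + 2 * max j.val (w m).val = totalDisp (w * Equiv.swap j m) + 2 * m := by
  unfold totalDisp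
  have hm : m ∈ Finset.univ.erase j := by simp [hjm.ne']
  rw [← Finset.add_sum_erase _ _ (Finset.mem_univ j), ← Finset.add_sum_erase _ _ hm,
    ← Finset.add_sum_erase Finset.univ (fun i => (((w * Equiv.swap j m) i : ℤ) - (i : ℤ)).natAbs)
      (Finset.mem_univ j), ← Finset.add_sum_erase _ _ hm]
  have : ∑ x ∈ (Finset.univ.erase j).erase m, (((w * Equiv.swap j m) x : ℤ) - (x : ℤ)).natAbs =
      ∑ x ∈ (Finset.univ.erase j).erase m, ((w x : ℤ) - (x : ℤ)).natAbs := by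
    refine Finset.sum_congr rfl fun x hx => ?_
    simp only [Finset.mem_erase, Finset.mem_univ, and_true] at hx
    rw [Equiv.Perm.mul_apply, Equiv.swap_apply_of_ne_of_ne hx.2 hx.1]
  rw [this]
  simp only [Equiv.Perm.mul_apply, Equiv.swap_apply_left, Equiv.swap_apply_right, hj]
  have : j.val < m.val := hjm
  have : (w m).val < m.val := hkm
  omega

/-- Diaconis–Graham inequality: for every permutation `w` of `{1,…,n}`,
`ℓ(w) + ℓ_T(w) ≤ td(w)`. -/
theorem length_add_reflLen_le_totalDisp {n : ℕ} (w : Equiv.Perm (Fin n)) :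
    invLen w + reflLen w ≤ totalDisp w := by
  induction hd : totalDisp w using Nat.strong_induction_on generalizing w with
  | _ d ih =>
  subst hd
  by_cases hw : w = 1
  · subst hw
    have h1 : invLen (1 : Equiv.Perm (Fin n)) = 0 := by
      simp only [invLen, Finset.card_eq_zero, Finset.filter_eq_empty_iff]
      exact fun p _ h => h.1.not_gt h.2
    have h2 : reflLen (1 : Equiv.Perm (Fin n)) = 0 := by simp [reflLen, numCycles]
    omega
  · have hne : w.support.Nonempty := by
      rwa [Finset.nonempty_iff_ne_empty, Ne, Equiv.Perm.support_eq_empty_iff]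
    let m := w.support.max' hne
    have hm : w m ≠ m := Equiv.Perm.mem_support.1 (w.support.max'_mem hne)
    have hfix : ∀ i, m < i → w i = i := fun i hi => by
      by_contra h
      exact absurd (w.support.le_max' i (Equiv.Perm.mem_support.2 h)) hi.not_ge
    have hkm : w m < m := lt_of_le_of_ne
      (w.support.le_max' _ (Equiv.Perm.apply_mem_support.2 (Equiv.Perm.mem_support.2 hm))) hm
    obtain ⟨j, hj⟩ := w.surjective m
    have hjm : j < m := by
      rcases lt_trichotomy j m with h | h | h
      · exact h
      · exact absurd (h ▸ hj) hm
      · exact absurd ((hfix j h).symm.trans hj) h.ne'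
    have hdisp := totalDisp_mul_swap w hj hjm hkm
    have hinv := invLen_le_mul_swap w hj hjm hkm hfix
    have hrefl := reflLen_le_mul_swap w hj hjm.ne
    have : j.val < m.val := hjm
    have : (w m).val < m.val := hkm
    have := ih _ (by omega) (w * Equiv.swap j m) rfl
    omega
end

section
/- Let n ≥ 2 and let w be a permutation of {1,…,n}. Then w is shallow if and only if there exists an index i with |w(i) − i| ≤ 1 such that the i-th flattening fl_i(w) is shallow. -/
open Equiv Equiv.Perm

/-- `w` moves the point `i` by at most one. -/
def IsNearAt {n : ℕ} (w : Perm (Fin n)) (i : Fin n) : Prop :=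
  ((w i : ℤ) - (i : ℤ)).natAbs ≤ 1

/-! ### Reflection length -/

lemma numCycles_add_card_support {n : ℕ} (w : Perm (Fin n)) :
    numCycles w + w.support.card = w.cycleType.card + n := by
  have h := Finset.card_filter_add_card_filter_not (s := Finset.univ) (fun i : Fin n => w i = i)
  have h' : w.support = Finset.univ.filter (fun i : Fin n => ¬ w i = i) := by
    ext; simp
  rw [Finset.card_univ, Fintype.card_fin, ← h'] at h
  unfold numCycles
  omega

lemma card_cycleType_le_card_support {n : ℕ} (w : Perm (Fin n)) :
    w.cycleType.card ≤ w.support.card := by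
  rw [← sum_cycleType]
  have := Multiset.card_nsmul_le_sum (s := w.cycleType) (a := 1)
    (fun x hx => (one_lt_of_mem_cycleType hx).le)
  simpa using this

lemma reflLen_add_card_cycleType {n : ℕ} (w : Perm (Fin n)) :
    reflLen w + w.cycleType.card = w.cycleType.sum := by
  have h₁ := numCycles_add_card_support w
  have h₂ := card_cycleType_le_card_support w
  have h₃ := w.support.card_le_univ
  rw [Fintype.card_fin] at h₃
  rw [sum_cycleType]
  unfold reflLen
  omega

lemma reflLen_mul_of_disjoint {n : ℕ} {u v : Perm (Fin n)} (h : u.Disjoint v) :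
    reflLen (u * v) = reflLen u + reflLen v := by
  have h₁ := reflLen_add_card_cycleType (u * v)
  have h₂ := reflLen_add_card_cycleType u
  have h₃ := reflLen_add_card_cycleType v
  rw [h.cycleType_mul, Multiset.card_add, Multiset.sum_add] at h₁
  omega

lemma reflLen_of_isCycle {n : ℕ} {c : Perm (Fin n)} (hc : c.IsCycle) :
    reflLen c + 1 = c.support.card := by
  have h := reflLen_add_card_cycleType c
  rwa [sum_cycleType, card_cycleType_eq_one.2 hc] at h

lemma reflLen_one {n : ℕ} : reflLen (1 : Perm (Fin n)) = 0 := by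
  have h := reflLen_add_card_cycleType (1 : Perm (Fin n))
  simpa using h

lemma reflLen_swap_mul_of_isCycle {n : ℕ} {c : Perm (Fin n)} (hc : c.IsCycle) {i : Fin n}
    (hi : c i ≠ i) : reflLen c = reflLen (swap i (c i) * c) + 1 := by
  have h := reflLen_of_isCycle hc
  by_cases hii : c (c i) = i
  · rw [hc.eq_swap_of_apply_apply_eq_self hi hii] at h ⊢
    rw [card_support_swap hi.symm] at h
    rw [swap_apply_left, swap_mul_self, reflLen_one]
    omega
  · have h' := reflLen_of_isCycle (hc.swap_mul hi hii)
    rw [support_swap_mul_eq _ _ hii, Finset.sdiff_singleton_eq_erase,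
      Finset.card_erase_of_mem (mem_support.2 hi)] at h'
    omega

/-- Splitting a non-fixed point off its cycle lowers the reflection length by one. -/
lemma reflLen_swap_mul {n : ℕ} (w : Perm (Fin n)) {i : Fin n} (hi : w i ≠ i) :
    reflLen w = reflLen (swap i (w i) * w) + 1 := by
  have hd := disjoint_mul_inv_of_mem_cycleFactorsFinset
    (cycleOf_mem_cycleFactorsFinset_iff.2 (mem_support.2 hi))
  have hcyc : (w.cycleOf i).IsCycle := isCycle_cycleOf w hi
  have hci : w.cycleOf i i = w i := cycleOf_apply_self w i
  generalize w.cycleOf i = c at hd hcyc hci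
  have hw : c * (w * c⁻¹) = w := by rw [← hd.commute.eq]; group
  have hd' : (swap i (c i) * c).Disjoint (w * c⁻¹) := fun x => by
    by_cases hx : x ∈ (swap i (c i) * c).support
    · exact .inr ((hd x).resolve_right
        (mem_support.1 (mem_support_swap_mul_imp_mem_support_ne hx).1))
    · exact .inl (notMem_support.1 hx)
  have h₁ := reflLen_mul_of_disjoint hd.symm
  have h₂ := reflLen_mul_of_disjoint hd'
  rw [mul_assoc, hw] at h₂
  rw [hw, reflLen_swap_mul_of_isCycle hcyc (hci ▸ hi)] at h₁
  rw [← hci, h₁, h₂]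
  omega

/-! ### Flattenings -/

lemma succAbove_flatten {n : ℕ} (w : Perm (Fin (n + 1))) (i : Fin (n + 1)) (k : Fin n) :
    (w i).succAbove (flatten w i k) = w (i.succAbove k) := by
  have hk : ∃ m, (finSuccEquiv' (w i)) (w ((finSuccEquiv' i).symm (some k))) = some m := by
    rw [← Option.ne_none_iff_exists', Ne, finSuccEquiv'_eq_none]
    simp
  have h := removeNone_some ((finSuccEquiv' i).symm.trans (w.trans (finSuccEquiv' (w i)))) hk
  have h' := congrArg (finSuccEquiv' (w i)).symm h
  simpa [flatten] using h'

lemma flatten_val {n : ℕ} (w : Perm (Fin (n + 1))) (i : Fin (n + 1)) (k : Fin n) :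
    (flatten w i k : ℕ) =
      if (w (i.succAbove k) : ℕ) < w i then (w (i.succAbove k) : ℕ) else w (i.succAbove k) - 1 := by
  rw [← succAbove_flatten]
  simp only [Fin.succAbove, Fin.lt_def]
  split_ifs <;> simp_all; omega

lemma reflLen_flatten_of_fixed {n : ℕ} (w : Perm (Fin (n + 1))) {i : Fin (n + 1)} (hi : w i = i) :
    reflLen (flatten w i) = reflLen w := by
  have hw : w = (flatten w i).extendDomain (finSuccAboveEquiv i) := by
    ext x : 1
    rcases Fin.eq_self_or_eq_succAbove i x with rfl | ⟨k, rfl⟩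
    · rw [extendDomain_apply_not_subtype _ _ (by simp), hi]
    · have := extendDomain_apply_image (flatten w i) (finSuccAboveEquiv i) k
      rw [← succAbove_flatten, hi]
      exact this.symm
  have h₁ := reflLen_add_card_cycleType w
  have h₂ := reflLen_add_card_cycleType (flatten w i)
  rw [hw, cycleType_extendDomain, ← hw] at h₁
  omega

lemma flatten_swap_mul {n : ℕ} (w : Perm (Fin (n + 1))) {i : Fin (n + 1)} (hi : IsNearAt w i) :
    flatten (swap i (w i) * w) i = flatten w i := by
  ext k
  have hne : w (i.succAbove k) ≠ w i := w.injective.ne (i.succAbove_ne k)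
  simp only [IsNearAt] at hi
  rw [flatten_val, flatten_val]
  simp only [Perm.mul_apply, swap_apply_right, swap_apply_def, if_neg hne]
  simp only [Fin.ext_iff] at *
  split_ifs <;> omega

lemma reflLen_flatten {n : ℕ} (w : Perm (Fin (n + 1))) {i : Fin (n + 1)} (hi : IsNearAt w i) :
    reflLen w = reflLen (flatten w i) + ((w i : ℤ) - i).natAbs := by
  by_cases h : w i = i
  · rw [reflLen_flatten_of_fixed w h]; simp [h]
  · rw [reflLen_swap_mul w h, ← flatten_swap_mul w hi, reflLen_flatten_of_fixed _ (by simp)]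
    simp only [IsNearAt] at hi
    simp only [Fin.ext_iff] at h
    omega

lemma invLen_eq_sum {n : ℕ} (w : Perm (Fin n)) :
    invLen w = ∑ a, ∑ b, if a < b ∧ w b < w a then 1 else 0 := by
  rw [invLen, Finset.card_filter, Fintype.sum_prod_type]

lemma invLen_flatten {n : ℕ} (w : Perm (Fin (n + 1))) (i : Fin (n + 1)) :
    invLen w = invLen (flatten w i) + ∑ k,
      ((if i < i.succAbove k ∧ w (i.succAbove k) < w i then 1 else 0) +
        if i.succAbove k < i ∧ w i < w (i.succAbove k) then 1 else 0) := by
  simp only [invLen_eq_sum, Fin.sum_univ_succAbove _ i, Finset.sum_add_distrib, lt_irrefl,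
    false_and, if_false, ← succAbove_flatten, Fin.succAbove_lt_succAbove_iff]
  omega

lemma totalDisp_flatten {n : ℕ} (w : Perm (Fin (n + 1))) {i : Fin (n + 1)} (hi : IsNearAt w i) :
    totalDisp w = totalDisp (flatten w i) + ((w i : ℤ) - i).natAbs + ∑ k,
      ((if i < i.succAbove k ∧ w (i.succAbove k) < w i then 1 else 0) +
        if i.succAbove k < i ∧ w i < w (i.succAbove k) then 1 else 0) := by
  rw [totalDisp, Fin.sum_univ_succAbove _ i, totalDisp, add_comm, add_right_comm,
    ← Finset.sum_add_distrib]
  congr 1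
  refine Finset.sum_congr rfl fun k _ => ?_
  have hne : w (i.succAbove k) ≠ w i := w.injective.ne (i.succAbove_ne k)
  have hne' : i.succAbove k ≠ i := i.succAbove_ne k
  have hv := flatten_val w i k
  have hk : (k : ℕ) = if i.succAbove k < i then (i.succAbove k : ℕ) else i.succAbove k - 1 := by
    simp only [Fin.succAbove, Fin.lt_def]
    split_ifs <;> simp_all; omega
  generalize i.succAbove k = x at *
  rw [hv, hk]
  simp only [IsNearAt] at hi
  simp only [Fin.lt_def] at *
  split_ifs <;> omega

lemma add_totalDisp_flatten {n : ℕ} (w : Perm (Fin (n + 1))) {i : Fin (n + 1)}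
    (hi : IsNearAt w i) : invLen w + reflLen w + totalDisp (flatten w i) =
      invLen (flatten w i) + reflLen (flatten w i) + totalDisp w := by
  rw [reflLen_flatten w hi, invLen_flatten w i, totalDisp_flatten w hi]
  omega

/-- Flattening at an index that is moved by at most one preserves and reflects shallowness. -/
lemma isShallow_flatten_iff {n : ℕ} (w : Perm (Fin (n + 1))) {i : Fin (n + 1)}
    (hi : IsNearAt w i) : IsShallow (flatten w i) ↔ IsShallow w := by
  have := add_totalDisp_flatten w hi
  unfold IsShallow
  omega

/-! ### Splitting off the last point -/

lemma isNearAt_last {n : ℕ} {w : Perm (Fin (n + 1))} (h : w (Fin.last n) = Fin.last n) :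
    IsNearAt w (Fin.last n) := by
  simp [IsNearAt, h]

/-- The permutation obtained from `w` by erasing the largest point from its cycle. -/
def eraseLast {n : ℕ} (w : Perm (Fin (n + 1))) : Perm (Fin n) :=
  flatten (swap (Fin.last n) (w (Fin.last n)) * w) (Fin.last n)

lemma swap_mul_last_apply {n : ℕ} (w : Perm (Fin (n + 1))) {k : Fin (n + 1)}
    (hk : k ≠ Fin.last n) : (swap (Fin.last n) (w (Fin.last n)) * w) k =
      if w k = Fin.last n then w (Fin.last n) else w k := by
  rw [Perm.mul_apply, swap_apply_def, if_neg (w.injective.ne hk)]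

lemma castSucc_eraseLast {n : ℕ} (w : Perm (Fin (n + 1))) (k : Fin n) :
    (eraseLast w k).castSucc =
      if w k.castSucc = Fin.last n then w (Fin.last n) else w k.castSucc := by
  have h := succAbove_flatten (swap (Fin.last n) (w (Fin.last n)) * w) (Fin.last n) k
  rwa [Perm.mul_apply _ _ (Fin.last n), swap_apply_right, Fin.succAbove_last,
    swap_mul_last_apply w k.castSucc_lt_last.ne] at h

lemma isShallow_eraseLast_iff {n : ℕ} (w : Perm (Fin (n + 1))) : IsShallow (eraseLast w) ↔
    IsShallow (swap (Fin.last n) (w (Fin.last n)) * w) :=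
  isShallow_flatten_iff _ (isNearAt_last (by simp))

/-- The positions to the right of `j`, other than the last one, whose entry exceeds the last
entry of `w`. -/
def upperRight {n : ℕ} (w : Perm (Fin (n + 1))) (j : Fin (n + 1)) : Finset (Fin (n + 1)) :=
  Finset.univ.filter fun k => j < k ∧ k < Fin.last n ∧ w (Fin.last n) < w k

lemma invLen_swap_mul {n : ℕ} (w : Perm (Fin (n + 1))) {j : Fin (n + 1)}
    (hj : w j = Fin.last n) (hjn : j ≠ Fin.last n) :
    invLen w =
      invLen (swap (Fin.last n) (w (Fin.last n)) * w) + 1 + 2 * (upperRight w j).card := by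
  set u := swap (Fin.last n) (w (Fin.last n)) * w with hu
  have hul : u (Fin.last n) = Fin.last n := by simp [hu]
  have huj : u j = w (Fin.last n) := by rw [hu, swap_mul_last_apply w hjn, if_pos hj]
  have huk : ∀ k, k ≠ j → k ≠ Fin.last n → u k = w k := fun k h₁ h₂ => by
    rw [hu, swap_mul_last_apply w h₂, if_neg (fun h => h₁ (w.injective (h.trans hj.symm)))]
  have hwk : ∀ k, k ≠ j → w k < Fin.last n := fun k h =>
    Fin.lt_last_iff_ne_last.2 fun h' => h (w.injective (h'.trans hj.symm))
  have hwl : ∀ k, k ≠ Fin.last n → w k ≠ w (Fin.last n) := fun k h => w.injective.ne h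
  have hle : ∀ k : Fin (n + 1), k ≤ Fin.last n := Fin.le_last
  set l := Fin.last n with hl
  have key : ∀ a b : Fin (n + 1),
      (if a < b ∧ w b < w a then 1 else 0) +
          (if b = j then if a < j ∧ w l < w a then 1 else 0 else 0) =
        (if a < b ∧ u b < u a then 1 else 0) +
          (if b = l then if w l < w a then 1 else 0 else 0) +
          (if a = j then if j < b ∧ b < l ∧ w l < w b then 1 else 0 else 0) := by
    intro a b
    have h₁ := huk a
    have h₂ := huk b
    have h₃ := hwk a
    have h₄ := hwk b
    have h₅ := hwl a
    have h₆ := hwl b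
    have h₇ := hle a
    have h₈ := hle b
    have h₉ := hwk l hjn.symm
    grind
  have hsum := Finset.sum_congr (rfl : Finset.univ = Finset.univ) fun a _ =>
    Finset.sum_congr (rfl : Finset.univ = Finset.univ) fun b _ => key a b
  simp only [Finset.sum_add_distrib, ← invLen_eq_sum, Finset.sum_ite_eq', Finset.mem_univ,
    if_true] at hsum
  rw [Finset.sum_comm (f := fun a b => if a = j then _ else _)] at hsum
  simp only [Finset.sum_ite_eq', Finset.mem_univ, if_true] at hsum
  have hpt : ∀ a : Fin (n + 1),
      (if w l < w a then 1 else 0) + (if j < a ∧ a < l ∧ w l < w a then 1 else 0) =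
        (if a < j ∧ w l < w a then 1 else 0) + (if a = j then 1 else 0) +
          2 * (if j < a ∧ a < l ∧ w l < w a then 1 else 0) := by
    intro a
    have h₃ := hwk a
    have h₅ := hwl a
    have h₇ := hle a
    have h₉ := hwk l hjn.symm
    grind
  have hsum' := Finset.sum_congr (rfl : Finset.univ = Finset.univ) fun a _ => hpt a
  simp only [Finset.sum_add_distrib, Finset.sum_ite_eq', Finset.mem_univ, if_true,
    ← Finset.mul_sum] at hsum'
  rw [upperRight, Finset.card_filter, ← hl]
  omega

lemma totalDisp_swap_mul {n : ℕ} (w : Perm (Fin (n + 1))) {j : Fin (n + 1)}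
    (hj : w j = Fin.last n) (hjn : j ≠ Fin.last n) :
    totalDisp w + 2 * max (j : ℕ) (w (Fin.last n)) =
      totalDisp (swap (Fin.last n) (w (Fin.last n)) * w) + 2 * n := by
  set u := swap (Fin.last n) (w (Fin.last n)) * w with hu
  have key : ∀ k, ((w k : ℤ) - k).natAbs +
        (if k = j then ((w (Fin.last n) : ℤ) - j).natAbs else 0) =
      ((u k : ℤ) - k).natAbs + (if k = j then n - j else 0) +
        (if k = Fin.last n then n - (w (Fin.last n) : ℕ) else 0) := by
    intro k
    by_cases hk : k = j
    · subst hk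
      have := k.is_le
      rw [hu, swap_mul_last_apply w hjn]
      simp only [hj, hjn, if_true, if_false, Fin.val_last]
      omega
    by_cases hkn : k = Fin.last n
    · subst hkn
      have := (w (Fin.last n)).is_le
      simp only [hu, hk, if_true, if_false, Fin.val_last, Perm.mul_apply, swap_apply_right]
      omega
    · have hwk : w k ≠ Fin.last n := fun h => hk (w.injective (h.trans hj.symm))
      rw [hu, swap_mul_last_apply w hkn, if_neg hwk]
      simp [hk, hkn]
  have hsum := Finset.sum_congr (rfl : Finset.univ = Finset.univ) fun k _ => key k
  simp only [Finset.sum_add_distrib, Finset.sum_ite_eq', Finset.mem_univ, if_true] at hsum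
  have h₁ := j.is_le
  have h₂ := (w (Fin.last n)).is_le
  unfold totalDisp
  omega

lemma upperRight_subset {n : ℕ} (w : Perm (Fin (n + 1))) (j : Fin (n + 1)) :
    upperRight w j ⊆ Finset.Ioo j (Fin.last n) := fun k hk => by
  simp only [upperRight, Finset.mem_filter, Finset.mem_univ, true_and] at hk
  exact Finset.mem_Ioo.2 ⟨hk.1, hk.2.1⟩

lemma map_upperRight_subset {n : ℕ} (w : Perm (Fin (n + 1))) {j : Fin (n + 1)}
    (hj : w j = Fin.last n) : (upperRight w j).map w.toEmbedding ⊆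
      Finset.Ioo (w (Fin.last n)) (Fin.last n) := fun x hx => by
  obtain ⟨k, hk, rfl⟩ := Finset.mem_map.1 hx
  simp only [upperRight, Finset.mem_filter, Finset.mem_univ, true_and] at hk
  refine Finset.mem_Ioo.2 ⟨hk.2.2, Fin.lt_last_iff_ne_last.2 fun h => hk.1.ne ?_⟩
  exact w.injective (hj.trans h.symm)

lemma card_upperRight_le {n : ℕ} (w : Perm (Fin (n + 1))) {j : Fin (n + 1)}
    (hj : w j = Fin.last n) :
    (upperRight w j).card ≤ n - max (j : ℕ) (w (Fin.last n)) - 1 := by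
  have h₁ := Finset.card_le_card (upperRight_subset w j)
  have h₂ := Finset.card_le_card (map_upperRight_subset w hj)
  rw [Finset.card_map] at h₂
  rw [Fin.card_Ioo, Fin.val_last] at h₁ h₂
  omega

lemma invLen_add_reflLen_le {n : ℕ} (w : Perm (Fin n)) : invLen w + reflLen w ≤ totalDisp w := by
  induction n with
  | zero =>
    have h := reflLen_add_card_cycleType w
    simp [Subsingleton.elim w 1, invLen] at h ⊢
    omega
  | succ n ih =>
    have hu := add_totalDisp_flatten (swap (Fin.last n) (w (Fin.last n)) * w)
      (isNearAt_last (by simp))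
    have hx := ih (eraseLast w)
    rw [eraseLast] at hx
    by_cases hwn : w (Fin.last n) = Fin.last n
    · simp only [hwn, swap_self] at hu hx
      change invLen (1 * w) + reflLen (1 * w) + _ = _ + totalDisp (1 * w) at hu
      simp only [one_mul] at hu
      omega
    · obtain ⟨j, hj⟩ := w.surjective (Fin.last n)
      have hjn : j ≠ Fin.last n := fun h => hwn (h ▸ hj)
      have h₁ := invLen_swap_mul w hj hjn
      have h₂ := totalDisp_swap_mul w hj hjn
      have h₃ := reflLen_swap_mul w hwn
      have h₄ := card_upperRight_le w hj
      have h₅ := Fin.lt_last_iff_ne_last.2 hjn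
      have h₆ := Fin.lt_last_iff_ne_last.2 hwn
      simp only [Fin.lt_def, Fin.val_last] at h₅ h₆
      omega

/-- Erasing the largest point from its cycle preserves shallowness. If the largest point is not
fixed, the new entry is a left-to-right maximum or a right-to-left minimum. -/
lemma IsShallow.eraseLast {n : ℕ} {w : Perm (Fin (n + 1))} (hw : IsShallow w) :
    IsShallow (eraseLast w) ∧ ∀ j : Fin n, w j.castSucc = Fin.last n →
      LeftToRightMaxAt (eraseLast w) j ∨ RightToLeftMinAt (eraseLast w) j := by
  rw [isShallow_eraseLast_iff]
  by_cases hwn : w (Fin.last n) = Fin.last n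
  · refine ⟨by rwa [hwn, swap_self, ← Perm.one_def, one_mul], fun j hj => ?_⟩
    exact absurd (w.injective (hj.trans hwn.symm)) j.castSucc_lt_last.ne
  obtain ⟨j, hj⟩ := w.surjective (Fin.last n)
  have hjn : j ≠ Fin.last n := fun h => hwn (h ▸ hj)
  have h₁ := invLen_swap_mul w hj hjn
  have h₂ := totalDisp_swap_mul w hj hjn
  have h₃ := reflLen_swap_mul w hwn
  have h₄ := card_upperRight_le w hj
  have h₅ := Fin.lt_last_iff_ne_last.2 hjn
  have h₆ := Fin.lt_last_iff_ne_last.2 hwn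
  have h₇ := invLen_add_reflLen_le (swap (Fin.last n) (w (Fin.last n)) * w)
  simp only [Fin.lt_def, Fin.val_last] at h₅ h₆
  unfold IsShallow at hw ⊢
  refine ⟨by omega, fun i hi => ?_⟩
  obtain rfl := w.injective (hi.trans hj.symm)
  have hval : ∀ k, k ≠ i → (_root_.eraseLast w k).castSucc = w k.castSucc := fun k hk => by
    rw [castSucc_eraseLast,
      if_neg fun h => hk (Fin.castSucc_injective _ (w.injective (h.trans hj.symm)))]
  have hvali : (_root_.eraseLast w i).castSucc = w (Fin.last n) := by
    rw [castSucc_eraseLast, if_pos hj]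
  have hcard : (upperRight w i.castSucc).card =
      n - max (i.castSucc : ℕ) (w (Fin.last n)) - 1 := by omega
  rcases le_total (i.castSucc : ℕ) (w (Fin.last n)) with h | h
  · left
    have heq := Finset.eq_of_subset_of_card_le (map_upperRight_subset w hj) (by
      rw [Finset.card_map, Fin.card_Ioo, Fin.val_last, hcard, max_eq_right h])
    intro k hk
    rw [← Fin.castSucc_lt_castSucc_iff, hval k hk.ne, hvali]
    by_contra hlt
    have hne : w k.castSucc ≠ w (Fin.last n) := w.injective.ne k.castSucc_lt_last.ne
    have hmem : w k.castSucc ∈ (upperRight w i.castSucc).map w.toEmbedding := by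
      rw [heq, Finset.mem_Ioo]
      refine ⟨lt_of_le_of_ne (not_lt.1 hlt) hne.symm, Fin.lt_last_iff_ne_last.2 fun h' => hk.ne ?_⟩
      exact Fin.castSucc_injective _ (w.injective (h'.trans hj.symm))
    rw [← Equiv.coe_toEmbedding, Finset.mem_map'] at hmem
    exact absurd (Finset.mem_Ioo.1 (upperRight_subset w _ hmem)).1 (by simpa using hk.le)
  · right
    have heq := Finset.eq_of_subset_of_card_le (upperRight_subset w i.castSucc) (by
      rw [Fin.card_Ioo, Fin.val_last, hcard, max_eq_left h])
    intro k hk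
    rw [← Fin.castSucc_lt_castSucc_iff, hval k hk.ne', hvali]
    have hmem : k.castSucc ∈ upperRight w i.castSucc := by
      rw [heq, Finset.mem_Ioo]
      exact ⟨by simpa using hk, k.castSucc_lt_last⟩
    simp only [upperRight, Finset.mem_filter] at hmem
    exact hmem.2.2.2

/-! ### Reversal -/

/-- Conjugation of `w` by the order-reversing permutation. -/
def revConj {n : ℕ} (w : Perm (Fin n)) : Perm (Fin n) :=
  Fin.revPerm.permCongr w

lemma revConj_rev {n : ℕ} (w : Perm (Fin n)) (k : Fin n) : revConj w k.rev = (w k).rev := by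
  simp [revConj]

lemma isNearAt_revConj {n : ℕ} (w : Perm (Fin n)) (k : Fin n) :
    IsNearAt (revConj w) k.rev ↔ IsNearAt w k := by
  rw [IsNearAt, IsNearAt, revConj_rev, Fin.val_rev, Fin.val_rev]
  omega

lemma IsShallow.revConj {n : ℕ} {w : Perm (Fin n)} (hw : IsShallow w) :
    IsShallow (revConj w) := by
  have h₁ : reflLen (_root_.revConj w) = reflLen w := by
    have h₁ := reflLen_add_card_cycleType w
    have h₂ := reflLen_add_card_cycleType (_root_.revConj w)
    have h₃ : (_root_.revConj w).cycleType = w.cycleType := by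
      rw [_root_.revConj, Equiv.permCongr_eq_mul, cycleType_conj]
    rw [h₃] at h₂
    omega
  have h₂ : invLen (_root_.revConj w) = invLen w := by
    rw [invLen_eq_sum, invLen_eq_sum, Finset.sum_comm, ← Equiv.sum_comp Fin.revPerm]
    refine Finset.sum_congr rfl fun a _ => ?_
    rw [← Equiv.sum_comp Fin.revPerm]
    refine Finset.sum_congr rfl fun b _ => ?_
    simp only [Fin.revPerm_apply, revConj_rev, Fin.rev_lt_rev]
  have h₃ : totalDisp (_root_.revConj w) = totalDisp w := by
    rw [totalDisp, totalDisp, ← Equiv.sum_comp Fin.revPerm]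
    refine Finset.sum_congr rfl fun a _ => ?_
    rw [Fin.revPerm_apply, revConj_rev, Fin.val_rev, Fin.val_rev]
    omega
  rw [IsShallow, h₁, h₂, h₃, hw]

lemma RightToLeftMinAt.revConj {n : ℕ} {w : Perm (Fin n)} {j : Fin n}
    (h : RightToLeftMinAt w j) : LeftToRightMaxAt (revConj w) j.rev := fun i hi => by
  rw [← i.rev_rev, revConj_rev, revConj_rev, Fin.rev_lt_rev]
  exact h _ (Fin.lt_rev_iff.1 hi)

/-! ### Existence of indices that are moved by at most one -/

/-- Every shallow permutation of `Fin n` with `0 < n` moves some index by at most one. -/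
def HasNear (n : ℕ) : Prop :=
  ∀ w : Perm (Fin n), IsShallow w → 0 < n → ∃ i, IsNearAt w i

/-- Every shallow permutation of `Fin n` with `2 ≤ n` moves by at most one some index other than
any given position of a left-to-right maximum or right-to-left minimum. -/
def HasOtherNear (n : ℕ) : Prop :=
  ∀ w : Perm (Fin n), IsShallow w → 2 ≤ n → ∀ j, LeftToRightMaxAt w j ∨ RightToLeftMinAt w j →
    ∃ i, i ≠ j ∧ IsNearAt w i

lemma exists_isNearAt_lt {a : ℕ} (ha : 0 < a) (h : HasNear a) {n : ℕ} (han : a ≤ n)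
    (w : Perm (Fin n)) (hw : IsShallow w) (hinv : ∀ k : Fin n, (k : ℕ) < a → (w k : ℕ) < a) :
    ∃ k : Fin n, (k : ℕ) < a ∧ IsNearAt w k := by
  induction n, han using Nat.le_induction with
  | base =>
    obtain ⟨k, hk⟩ := h w hw ha
    exact ⟨k, k.is_lt, hk⟩
  | succ n han ih =>
    have hval : ∀ k : Fin n, (k : ℕ) < a → (eraseLast w k).castSucc = w k.castSucc := by
      intro k hk
      have hlt := hinv k.castSucc hk
      rw [castSucc_eraseLast, if_neg fun h => ?_]
      rw [h, Fin.val_last] at hlt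
      omega
    obtain ⟨k, hk, hnear⟩ := ih (eraseLast w) hw.eraseLast.1 fun k hk => by
      rw [← Fin.val_castSucc, hval k hk]
      exact hinv k.castSucc hk
    refine ⟨k.castSucc, hk, ?_⟩
    rwa [IsNearAt, ← hval k hk]

lemma exists_isNearAt_ge {a n : ℕ} (han : a < n) (h : HasNear (n - a))
    (w : Perm (Fin n)) (hw : IsShallow w) (hinv : ∀ k : Fin n, a ≤ k → a ≤ w k) :
    ∃ k : Fin n, a ≤ k ∧ IsNearAt w k := by
  obtain ⟨k, hk, hnear⟩ := exists_isNearAt_lt (Nat.sub_pos_of_lt han) h (Nat.sub_le _ _)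
    (revConj w) hw.revConj fun k hk => by
      have := hinv k.rev (by rw [Fin.val_rev]; omega)
      rw [← k.rev_rev, revConj_rev, Fin.val_rev]
      omega
  refine ⟨k.rev, by rw [Fin.val_rev]; omega, ?_⟩
  rwa [← isNearAt_revConj, Fin.rev_rev]

lemma hasNear_succ {n : ℕ} (h : HasOtherNear n) : HasNear (n + 1) := by
  intro w hw _
  by_cases hwn : w (Fin.last n) = Fin.last n
  · exact ⟨_, isNearAt_last hwn⟩
  by_cases hn : n < 2
  · refine ⟨0, ?_⟩
    have := (w 0).is_le
    simp only [IsNearAt, Fin.val_zero]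
    omega
  obtain ⟨j, hj⟩ := w.surjective (Fin.last n)
  have hjn : j ≠ Fin.last n := fun h => hwn (h ▸ hj)
  obtain ⟨j, rfl⟩ := Fin.exists_castSucc_eq.2 hjn
  obtain ⟨i, hij, hi⟩ := h (eraseLast w) hw.eraseLast.1 (not_lt.1 hn) j (hw.eraseLast.2 j hj)
  refine ⟨i.castSucc, ?_⟩
  rw [IsNearAt, ← Fin.val_castSucc (eraseLast w i), castSucc_eraseLast, if_neg fun h => hij ?_] at hi
  · exact hi
  · exact Fin.castSucc_injective _ (w.injective (h.trans hj.symm))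

/-- A permutation sending every position before `j` to a value at most `j`
sends at most one position after `j` to such a value. -/
lemma eq_of_lt_of_apply_le {n : ℕ} {w : Perm (Fin n)} {j : Fin n} (h : ∀ k < j, w k ≤ j)
    {a b : Fin n} (ha : j < a) (hwa : w a ≤ j) (hb : j < b) (hwb : w b ≤ j) : a = b := by
  by_contra hab
  have hsub : (insert a (insert b (Finset.Iio j))).map w.toEmbedding ⊆ Finset.Iic j := by
    intro x hx
    obtain ⟨k, hk, rfl⟩ := Finset.mem_map.1 hx
    simp only [Finset.mem_insert, Finset.mem_Iio] at hk
    rw [Finset.mem_Iic]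
    rcases hk with rfl | rfl | hk
    exacts [hwa, hwb, h k hk]
  have hcard := Finset.card_le_card hsub
  rw [Finset.card_map, Finset.card_insert_of_notMem (by simp [hab, ha.le]),
    Finset.card_insert_of_notMem (by simp [hb.le]), Fin.card_Iio, Fin.card_Iic] at hcard
  omega

lemma LeftToRightMaxAt.le_apply {n : ℕ} {w : Perm (Fin n)} {j : Fin n}
    (h : LeftToRightMaxAt w j) : j ≤ w j := by
  have hsub : (Finset.Iio j).map w.toEmbedding ⊆ Finset.Iio (w j) := by
    intro x hx
    obtain ⟨k, hk, rfl⟩ := Finset.mem_map.1 hx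
    exact Finset.mem_Iio.2 (h k (Finset.mem_Iio.1 hk))
  have hcard := Finset.card_le_card hsub
  rwa [Finset.card_map, Fin.card_Iio, Fin.card_Iio] at hcard

/-- The case of a left-to-right maximum at a fixed point. -/
lemma exists_ne_isNearAt_of_fixed {n : ℕ} (h : ∀ m < n, HasNear m) (hn : 2 ≤ n)
    {w : Perm (Fin n)} (hw : IsShallow w) {j : Fin n} (hj : LeftToRightMaxAt w j)
    (hwj : w j = j) : ∃ i, i ≠ j ∧ IsNearAt w i := by
  rcases Nat.eq_zero_or_pos (j : ℕ) with hj0 | hj0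
  · obtain ⟨i, hi, hnear⟩ := exists_isNearAt_ge (a := 1) (by omega) (h (n - 1) (by omega)) w hw
      fun k hk => by
        by_contra hlt
        have : w k = w j := by rw [hwj, Fin.ext_iff]; omega
        rw [w.injective this] at hk
        omega
    exact ⟨i, fun hij => by rw [hij] at hi; omega, hnear⟩
  · obtain ⟨i, hi, hnear⟩ := exists_isNearAt_lt hj0 (h j j.is_lt) j.is_lt.le w hw
      fun k hk => by
        have := hj k hk
        rwa [hwj] at this
    exact ⟨i, Fin.ne_of_lt hi, hnear⟩

/-- The case of a left-to-right maximum at a position that is moved up by one. -/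
lemma exists_ne_isNearAt_of_succ {n : ℕ} (h : HasNear n) (h' : HasOtherNear n) (hn : 2 ≤ n)
    {w : Perm (Fin (n + 1))} (hw : IsShallow w) {j : Fin (n + 1)} (hj : LeftToRightMaxAt w j)
    (hwj : (w j : ℕ) = j + 1) : ∃ i, i ≠ j ∧ IsNearAt w i := by
  by_contra! hno
  have hle : ∀ k < j, w k ≤ j := fun k hk => by
    have := hj k hk
    rw [Fin.lt_def] at this
    rw [Fin.le_def]
    omega
  have hx : IsShallow (flatten w j) :=
    (isShallow_flatten_iff w (by rw [IsNearAt]; omega)).2 hw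
  have hval := flatten_val w j
  have hsA : ∀ k : Fin n,
      (j.succAbove k : ℕ) = if (k : ℕ) < j then (k : ℕ) else k + 1 := fun k => by
    simp only [Fin.succAbove, Fin.lt_def, Fin.val_castSucc]
    split_ifs <;> rfl
  have huniq : ∀ k l : Fin n, (j : ℕ) ≤ k → (w (j.succAbove k) : ℕ) ≤ j → (j : ℕ) ≤ l →
      (w (j.succAbove l) : ℕ) ≤ j → k = l := fun k l hk hwk hl hwl => by
    refine Fin.succAbove_right_injective (eq_of_lt_of_apply_le hle ?_ hwk ?_ hwl)
    · rw [Fin.lt_def, hsA, if_neg (by omega)]; omega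
    · rw [Fin.lt_def, hsA, if_neg (by omega)]; omega
  have hcases : ∀ k, IsNearAt (flatten w j) k →
      (j : ℕ) ≤ k ∧ (w (j.succAbove k) : ℕ) ≤ j := by
    intro k hk
    have h₁ := hno _ (j.succAbove_ne k)
    have h₂ := hval k
    have h₃ := hsA k
    have h₄ : (w (j.succAbove k) : ℕ) ≠ j + 1 := fun h =>
      w.injective.ne (j.succAbove_ne k) (Fin.ext (h.trans hwj.symm))
    have h₅ := hle (j.succAbove k)
    rw [Fin.lt_def, Fin.le_def] at h₅
    unfold IsNearAt at hk h₁
    split_ifs at h₂ h₃ <;> omega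
  obtain ⟨k, hk⟩ := h _ hx (by omega)
  obtain ⟨hjk, hwk⟩ := hcases k hk
  have hmin : RightToLeftMinAt (flatten w j) k := by
    intro l hl
    have h₁ := fun hwl => huniq k l hjk hwk (hjk.trans hl.le) hwl
    have h₂ : (w (j.succAbove l) : ℕ) ≠ j + 1 := fun h =>
      w.injective.ne (j.succAbove_ne l) (Fin.ext (h.trans hwj.symm))
    have h₃ : ¬ (w (j.succAbove l) : ℕ) ≤ j := fun hwl => hl.ne (h₁ hwl)
    rw [Fin.lt_def, hval, hval, if_pos (by omega), if_neg (by omega)]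
    omega
  obtain ⟨l, hlk, hl⟩ := h' _ hx hn k (.inr hmin)
  obtain ⟨hjl, hwl⟩ := hcases l hl
  exact hlk (huniq l k hjl hwl hjk hwk)

lemma hasNear_and_hasOtherNear (n : ℕ) : HasNear n ∧ HasOtherNear n := by
  induction n using Nat.strong_induction_on with
  | _ n ih =>
    rcases n with - | n
    · exact ⟨fun _ _ h => absurd h (lt_irrefl _), fun _ _ h => absurd h (by omega)⟩
    have hN := hasNear_succ (ih n n.lt_succ_self).2
    have hleft : ∀ w : Perm (Fin (n + 1)), IsShallow w → 2 ≤ n + 1 → ∀ j,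
        LeftToRightMaxAt w j → ∃ i, i ≠ j ∧ IsNearAt w i := by
      intro w hw hn j hj
      by_cases hn2 : n < 2
      · have : Nontrivial (Fin (n + 1)) := Fin.nontrivial_iff_two_le.2 hn
        obtain ⟨i, hi⟩ := exists_ne j
        have h₁ := i.is_le
        have h₂ := (w i).is_le
        exact ⟨i, hi, by rw [IsNearAt]; omega⟩
      by_contra hno
      obtain ⟨i, hi⟩ := hN w hw n.succ_pos
      have hij : i = j := by
        by_contra hij
        exact hno ⟨i, hij, hi⟩
      subst hij
      have hle := hj.le_apply
      rw [IsNearAt] at hi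
      rw [Fin.le_def] at hle
      rcases hle.eq_or_lt with heq | hlt
      · exact hno (exists_ne_isNearAt_of_fixed (fun m hm => (ih m hm).1) hn hw hj
          (Fin.ext heq.symm))
      · exact hno (exists_ne_isNearAt_of_succ (ih n n.lt_succ_self).1 (ih n n.lt_succ_self).2
          (not_lt.1 hn2) hw hj (by omega))
    refine ⟨hN, fun w hw hn j hj => ?_⟩
    rcases hj with hj | hj
    · exact hleft w hw hn j hj
    · obtain ⟨i, hi, hnear⟩ := hleft _ hw.revConj hn _ hj.revConj
      refine ⟨i.rev, fun h => hi ?_, ?_⟩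
      · rw [← h, Fin.rev_rev]
      · rwa [← isNearAt_revConj, Fin.rev_rev]

/-- For `n ≥ 2`, a permutation `w` of `{1,…,n}` is shallow if and only if there is an
index `i` with `|w i - i| ≤ 1` whose flattening `fl_i(w)` is shallow. -/
theorem isShallow_iff_exists_flatten {n : ℕ} (hn : 1 ≤ n) (w : Equiv.Perm (Fin (n + 1))) :
    IsShallow w ↔
      ∃ i : Fin (n + 1), ((w i : ℤ) - (i : ℤ)).natAbs ≤ 1 ∧ IsShallow (flatten w i) := by
  refine ⟨fun hw => ?_, fun ⟨i, hi, hx⟩ => (isShallow_flatten_iff w hi).1 hx⟩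
  obtain ⟨i, hi⟩ := (hasNear_and_hasOtherNear (n + 1)).1 w hw n.succ_pos
  exact ⟨i, hi, (isShallow_flatten_iff w hi).2 hw⟩
end

section
/- Let n ≥ 2 and let w be a permutation of {1,…,n} with w(n) = n. Then w is shallow if and only if the permutation w' of {1,…,n−1} defined by w'(i) = w(i) for all 1 ≤ i ≤ n−1 is shallow. -/
section FixedLast

variable {n : ℕ} {w : Equiv.Perm (Fin (n + 1))} {w' : Equiv.Perm (Fin n)}

theorem apply_castSucc_of_restrict (hw' : ∀ i : Fin n, (w' i : ℕ) = (w i.castSucc : ℕ))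
    (i : Fin n) : w i.castSucc = (w' i).castSucc :=
  Fin.ext (hw' i).symm

theorem eq_extendDomain_of_restrict (hlast : w (Fin.last n) = Fin.last n)
    (hw' : ∀ i : Fin n, (w' i : ℕ) = (w i.castSucc : ℕ)) :
    w = w'.extendDomain (finSuccAboveEquiv (Fin.last n)) := by
  ext1 i
  induction i using Fin.lastCases with
  | last => rw [hlast, Equiv.Perm.extendDomain_apply_not_subtype _ _ (by simp)]
  | cast i =>
    have h := Equiv.Perm.extendDomain_apply_image w' (finSuccAboveEquiv (Fin.last n)) i
    simp only [finSuccAboveEquiv_apply, Fin.succAbove_last] at h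
    rw [h, apply_castSucc_of_restrict hw']

theorem invLen_eq_of_restrict (hlast : w (Fin.last n) = Fin.last n)
    (hw' : ∀ i : Fin n, (w' i : ℕ) = (w i.castSucc : ℕ)) : invLen w = invLen w' := by
  simp only [invLen, Finset.card_filter, Fintype.sum_prod_type, Fin.sum_univ_castSucc, hlast,
    apply_castSucc_of_restrict hw', Fin.castSucc_lt_castSucc_iff]
  simp [Fin.not_lt.2 (Fin.le_last _)]

theorem numCycles_eq_of_restrict (hlast : w (Fin.last n) = Fin.last n)
    (hw' : ∀ i : Fin n, (w' i : ℕ) = (w i.castSucc : ℕ)) :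
    numCycles w = numCycles w' + 1 := by
  have hcycle : w.cycleType = w'.cycleType := by
    rw [eq_extendDomain_of_restrict hlast hw', Equiv.Perm.cycleType_extendDomain]
  simp only [numCycles, hcycle, Finset.card_filter, Fin.sum_univ_castSucc, hlast,
    apply_castSucc_of_restrict hw', Fin.castSucc_inj, if_true, add_assoc]

theorem reflLen_eq_of_restrict (hlast : w (Fin.last n) = Fin.last n)
    (hw' : ∀ i : Fin n, (w' i : ℕ) = (w i.castSucc : ℕ)) : reflLen w = reflLen w' := by
  rw [reflLen, reflLen, numCycles_eq_of_restrict hlast hw', Nat.add_sub_add_right]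

theorem totalDisp_eq_of_restrict (hlast : w (Fin.last n) = Fin.last n)
    (hw' : ∀ i : Fin n, (w' i : ℕ) = (w i.castSucc : ℕ)) : totalDisp w = totalDisp w' := by
  simp [totalDisp, Fin.sum_univ_castSucc, hlast, apply_castSucc_of_restrict hw']

end FixedLast

/-- For `n ≥ 2` and `w` with `w(n) = n`, `w` is shallow if and only if the permutation
`w'` of `{1,…,n-1}` defined by `w'(i) = w(i)` is shallow. -/
theorem isShallow_iff_restrict {n : ℕ} (hn : 1 ≤ n) (w : Equiv.Perm (Fin (n + 1)))
    (hlast : w (Fin.last n) = Fin.last n)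
    (w' : Equiv.Perm (Fin n)) (hw' : ∀ i : Fin n, (w' i : ℕ) = (w i.castSucc : ℕ)) :
    IsShallow w ↔ IsShallow w' := by
  rw [IsShallow, IsShallow, invLen_eq_of_restrict hlast hw', reflLen_eq_of_restrict hlast hw',
    totalDisp_eq_of_restrict hlast hw']
end
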